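/- arXiv:2310.00724 — 3 statements merged into one kernel-verified Lean document; each statement's English description precedes it below -/
import Mathlib

section
/- Let n be a natural number and let M be the 2ⁿ × 2ⁿ real matrix whose rows and columns are indexed by Boolean vectors y, z ∈ {0,1}ⁿ and whose entries are M(y,z) = (1 − Σ_{i=1}^n yᵢ·zᵢ)². If M = B·C for an entrywise non-negative 2ⁿ × k matrix B and an entrywise non-negative k × 2ⁿ matrix C, then k ≥ (3/2)ⁿ. That is, the non-negative rank of the unique disjointness matrix is at least (3/2)ⁿ. -/
open Classical in
/-- number of common ones -/
noncomputable def udInter {n : ℕ} (y z : Fin n → Bool) : ℕ :=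
  ∑ i, if y i = true ∧ z i = true then 1 else 0

open Classical in
/-- number of disjoint pairs in a rectangle -/
noncomputable def udCount {n : ℕ} (S T : (Fin n → Bool) → Prop) : ℕ :=
  ∑ y, ∑ z, if udInter y z = 0 ∧ S y ∧ T z then 1 else 0

theorem ud_sum_cons {n : ℕ} (f : (Fin (n + 1) → Bool) → ℕ) :
    ∑ y, f y = ∑ y : Fin n → Bool, (f (Fin.cons true y) + f (Fin.cons false y)) := by
  rw [← (Fin.consEquiv (fun _ : Fin (n + 1) => Bool)).sum_comp, Fintype.sum_prod_type,
    Fintype.sum_bool, ← Finset.sum_add_distrib]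
  rfl

theorem udInter_cons {n : ℕ} (a b : Bool) (y z : Fin n → Bool) :
    udInter (Fin.cons a y : Fin (n + 1) → Bool) (Fin.cons b z)
      = (if a = true ∧ b = true then 1 else 0) + udInter y z := by
  unfold udInter
  rw [Fin.sum_univ_succ]
  simp

theorem udCount_all (n : ℕ) : udCount (n := n) (fun _ => True) (fun _ => True) = 3 ^ n := by
  induction n with
  | zero => simp [udCount, udInter]
  | succ n ih =>
    rw [pow_succ, ← ih]
    unfold udCount
    rw [ud_sum_cons, Finset.sum_mul]
    refine Finset.sum_congr rfl fun y _ => ?_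
    rw [ud_sum_cons, ud_sum_cons, Finset.sum_mul, ← Finset.sum_add_distrib]
    refine Finset.sum_congr rfl fun z _ => ?_
    simp only [udInter_cons]
    by_cases h : udInter y z = 0 <;> simp [h]

theorem udCount_le (n : ℕ) (S T : (Fin n → Bool) → Prop)
    (h : ∀ y z, S y → T z → udInter y z ≠ 1) : udCount S T ≤ 2 ^ n := by
  induction n with
  | zero =>
    simp only [udCount, Fintype.sum_unique, pow_zero]
    split_ifs <;> simp
  | succ n ih =>
    have h1 := ih (fun y => S (Fin.cons false y) ∨ S (Fin.cons true y))
      (fun z => T (Fin.cons false z)) (by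
        rintro y z (hy | hy) hz <;> simpa [udInter_cons] using h _ _ hy hz)
    have h2 := ih (fun y => S (Fin.cons false y))
      (fun z => T (Fin.cons false z) ∨ T (Fin.cons true z)) (by
        rintro y z hy (hz | hz) <;> simpa [udInter_cons] using h _ _ hy hz)
    rw [pow_succ, mul_two]
    refine le_trans ?_ (add_le_add h1 h2)
    unfold udCount
    rw [ud_sum_cons, ← Finset.sum_add_distrib]
    refine Finset.sum_le_sum fun y _ => ?_
    rw [ud_sum_cons, ud_sum_cons, ← Finset.sum_add_distrib, ← Finset.sum_add_distrib]
    refine Finset.sum_le_sum fun z _ => ?_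
    have e1 : udInter (Fin.cons true y : Fin (n + 1) → Bool) (Fin.cons true z) ≠ 0 := by
      rw [udInter_cons]; simp
    have e2 : udInter (Fin.cons true y : Fin (n + 1) → Bool) (Fin.cons false z) = udInter y z := by
      rw [udInter_cons]; simp
    have e3 : udInter (Fin.cons false y : Fin (n + 1) → Bool) (Fin.cons true z) = udInter y z := by
      rw [udInter_cons]; simp
    have e4 : udInter (Fin.cons false y : Fin (n + 1) → Bool) (Fin.cons false z) = udInter y z := by
      rw [udInter_cons]; simp
    have h3 := h (Fin.cons true y) (Fin.cons true z)
    rw [udInter_cons] at h3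
    by_cases h0 : udInter y z = 0
    · by_cases a : S (Fin.cons false y) <;> by_cases b : S (Fin.cons true y) <;>
      by_cases c : T (Fin.cons false z) <;> by_cases d : T (Fin.cons true z) <;>
      simp [e1, e2, e3, e4, h0, a, b, c, d] <;> simp_all
    · simp [e1, e2, e3, e4, h0]

/-- Lower bound on the non-negative rank of the unique disjointness matrix
`M(y,z) = (1 − ⟨y,z⟩)²`: any non-negative factorization has inner dimension at least
`(3/2)ⁿ`. -/
theorem udisj_matrix_nonneg_rank_lower_bound
    (n k : ℕ)
    (B : Matrix (Fin n → Bool) (Fin k) ℝ) (C : Matrix (Fin k) (Fin n → Bool) ℝ)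
    (hB : ∀ y j, 0 ≤ B y j) (hC : ∀ j z, 0 ≤ C j z)
    (hfac : ∀ y z : Fin n → Bool,
      (1 - ∑ i, (if y i then (1 : ℝ) else 0) * (if z i then (1 : ℝ) else 0)) ^ 2
        = (B * C) y z) :
    ((3 : ℝ) / 2) ^ n ≤ (k : ℝ) := by
  classical
  have hI : ∀ y z : Fin n → Bool,
      (1 - (udInter y z : ℝ)) ^ 2 = ∑ j, B y j * C j z := by
    intro y z
    rw [← Matrix.mul_apply, ← hfac]
    congr 2
    unfold udInter
    push_cast
    refine Finset.sum_congr rfl fun i _ => ?_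
    cases y i <;> cases z i <;> simp
  have hle : ∀ j, udCount (fun y => 0 < B y j) (fun z => 0 < C j z) ≤ 2 ^ n := by
    intro j
    refine udCount_le n _ _ fun y z hy hz h1 => ?_
    have := hI y z
    rw [h1] at this
    have h2 := Finset.single_le_sum (f := fun j => B y j * C j z)
      (fun j _ => mul_nonneg (hB y j) (hC j z)) (Finset.mem_univ j)
    have h3 := mul_pos hy hz
    norm_num at this
    linarith
  have hcov : 3 ^ n ≤ ∑ j, udCount (fun y => 0 < B y j) (fun z => 0 < C j z) := by
    rw [← udCount_all]
    unfold udCount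
    rw [Finset.sum_comm (s := (Finset.univ : Finset (Fin k)))]
    refine Finset.sum_le_sum fun y _ => ?_
    rw [Finset.sum_comm (s := (Finset.univ : Finset (Fin k)))]
    refine Finset.sum_le_sum fun z _ => ?_
    by_cases h0 : udInter y z = 0
    · have := hI y z
      rw [h0] at this
      obtain ⟨j, -, hj⟩ : ∃ j ∈ Finset.univ, B y j * C j z ≠ 0 := by
        apply Finset.exists_ne_zero_of_sum_ne_zero
        rw [← this]; norm_num
      have hb := (hB y j).lt_of_ne' (left_ne_zero_of_mul hj)
      have hc := (hC j z).lt_of_ne' (right_ne_zero_of_mul hj)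
      refine le_trans ?_ (Finset.single_le_sum (fun _ _ => Nat.zero_le _) (Finset.mem_univ j))
      simp [h0, hb, hc]
    · simp [h0]
  have hfin : 3 ^ n ≤ k * 2 ^ n := by
    refine hcov.trans ((Finset.sum_le_sum fun j _ => hle j).trans ?_)
    simp
  rw [div_pow, div_le_iff₀ (by positivity)]
  exact_mod_cast hfin
end

section
/- Let n and N be natural numbers, and suppose there exist entrywise non-negative functions f_k, h_k : {0,1}ⁿ → ℝ for k = 1, …, N such that for all Boolean vectors y, z ∈ {0,1}ⁿ, (1 − Σ_{i=1}^n yᵢ·zᵢ)² = Σ_{k=1}^N f_k(y)·h_k(z). Then N ≥ (3/2)ⁿ. In particular, any representation of the unique disjointness function of a matching of size n as a sum of non-negative balanced products, where every matched pair is split across the partition, requires exponentially many summands. -/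
theorem kw_sum_cons {n : ℕ} (g : (Fin (n+1) → Bool) → ℕ) :
    ∑ y, g y = ∑ y : Fin n → Bool, (g (Fin.cons false y) + g (Fin.cons true y)) := by
  rw [← (Fin.consEquiv (fun _ : Fin (n+1) => Bool)).sum_comp, Fintype.sum_prod_type,
    Fintype.sum_bool, Finset.sum_add_distrib, add_comm]
  rfl

def KWD {n : ℕ} (y z : Fin n → Bool) : Prop := ∀ i, ¬ (y i = true ∧ z i = true)

def KWU {n : ℕ} (y z : Fin n → Bool) : Prop := ∃! i, (y i = true ∧ z i = true)

theorem kwD_cons {n : ℕ} (b c : Bool) (y z : Fin n → Bool) :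
    KWD (Fin.cons b y : Fin (n+1) → Bool) (Fin.cons c z) ↔ (¬ (b = true ∧ c = true)) ∧ KWD y z := by
  simp [KWD, Fin.forall_fin_succ]

theorem kwU_cons {n : ℕ} (b c : Bool) (y z : Fin n → Bool) (hbc : ¬ (b = true ∧ c = true))
    (hu : KWU y z) : KWU (Fin.cons b y : Fin (n+1) → Bool) (Fin.cons c z) := by
  obtain ⟨i, hi, hu⟩ := hu
  refine ⟨i.succ, by simpa using hi, fun j => ?_⟩
  refine Fin.cases ?_ (fun j => ?_) j
  · intro h; exact absurd (by simpa using h) hbc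
  · intro h; rw [hu j (by simpa using h)]

theorem kwU_cons_true {n : ℕ} (y z : Fin n → Bool) 
    (hd : KWD y z) : KWU (Fin.cons true y : Fin (n+1) → Bool) (Fin.cons true z) := by
  refine ⟨0, by simp, fun j => ?_⟩
  refine Fin.cases ?_ (fun j => ?_) j
  · intro h; rfl
  · intro h; exact absurd (by simpa using h) (hd j)

open Classical in
theorem kw_total (n : ℕ) :
    ∑ y : Fin n → Bool, ∑ z : Fin n → Bool, (if KWD y z then 1 else 0) = 3 ^ n := by
  induction n with
  | zero => simp [KWD]
  | succ n ih =>
    rw [kw_sum_cons, pow_succ, ← ih, Finset.sum_mul]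
    refine Finset.sum_congr rfl fun y _ => ?_
    rw [kw_sum_cons, kw_sum_cons, ← Finset.sum_add_distrib, Finset.sum_mul]
    refine Finset.sum_congr rfl fun z _ => ?_
    simp only [kwD_cons]
    by_cases hd : KWD y z <;> simp [hd]

open Classical in
theorem kw_rect (n : ℕ) (A B : (Fin n → Bool) → Prop)
    (hAB : ∀ y z, A y → B z → ¬ KWU y z) :
    ∑ y : Fin n → Bool, ∑ z : Fin n → Bool, (if A y ∧ B z ∧ KWD y z then 1 else 0) ≤ 2 ^ n := by
  induction n with
  | zero => simp only [Fintype.sum_unique]; split_ifs <;> simp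
  | succ n ih =>
    have h1 := ih (fun y => A (Fin.cons false y) ∨ A (Fin.cons true y))
      (fun z => B (Fin.cons false z)) (by
        rintro y z (ha | ha) hb hu
        · exact hAB _ _ ha hb (kwU_cons _ _ _ _ (by simp) hu)
        · exact hAB _ _ ha hb (kwU_cons _ _ _ _ (by simp) hu))
    have h2 := ih (fun y => A (Fin.cons false y))
      (fun z => B (Fin.cons false z) ∨ B (Fin.cons true z)) (by
        rintro y z ha (hb | hb) hu
        · exact hAB _ _ ha hb (kwU_cons _ _ _ _ (by simp) hu)
        · exact hAB _ _ ha hb (kwU_cons _ _ _ _ (by simp) hu))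
    rw [pow_succ, mul_two]
    refine le_trans ?_ (add_le_add h1 h2)
    rw [kw_sum_cons, ← Finset.sum_add_distrib]
    refine Finset.sum_le_sum fun y _ => ?_
    rw [kw_sum_cons, kw_sum_cons, ← Finset.sum_add_distrib, ← Finset.sum_add_distrib]
    refine Finset.sum_le_sum fun z _ => ?_
    simp only [kwD_cons]
    by_cases hd : KWD y z
    · have h3 : ¬ (A (Fin.cons true y) ∧ B (Fin.cons true z)) :=
        fun h => hAB _ _ h.1 h.2 (kwU_cons_true y z hd)
      by_cases a0 : A (Fin.cons false y) <;> by_cases a1 : A (Fin.cons true y) <;>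
      by_cases b0 : B (Fin.cons false z) <;> by_cases b1 : B (Fin.cons true z) <;>
      simp_all
    · simp [hd]

/-- Any representation of the unique disjointness function of a matching of size `n`,
`(y,z) ↦ (1 − ∑ᵢ yᵢzᵢ)²`, as a sum of `N` products of non-negative functions of `y`
and of `z` requires `N ≥ (3/2)ⁿ`. -/
theorem udisj_matching_balanced_products_lower_bound
    (n N : ℕ)
    (f : Fin N → (Fin n → Bool) → ℝ) (h : Fin N → (Fin n → Bool) → ℝ)
    (hf : ∀ k y, 0 ≤ f k y) (hh : ∀ k z, 0 ≤ h k z)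
    (hdecomp : ∀ y z : Fin n → Bool,
      (1 - ∑ i, (if y i then (1 : ℝ) else 0) * (if z i then (1 : ℝ) else 0)) ^ 2
        = ∑ k, f k y * h k z) :
    ((3 : ℝ) / 2) ^ n ≤ (N : ℝ) := by
  classical
  have hs : ∀ y z : Fin n → Bool, ∀ i,
      (if y i then (1 : ℝ) else 0) * (if z i then (1 : ℝ) else 0)
        = if (y i = true ∧ z i = true) then 1 else 0 := by
    intro y z i
    by_cases h1 : y i = true <;> by_cases h2 : z i = true <;> simp [h1, h2]
  have hrect : ∀ k, ∀ y z, 0 < f k y → 0 < h k z → ¬ KWU y z := by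
    rintro k y z hy hz ⟨i, hi, hu⟩
    have e := hdecomp y z
    simp only [hs] at e
    rw [Finset.sum_eq_single i (fun j _ hj => if_neg (fun hc => hj (hu j hc))) (by simp),
      if_pos hi] at e
    have := Finset.single_le_sum (f := fun k => f k y * h k z)
      (fun k _ => mul_nonneg (hf k y) (hh k z)) (Finset.mem_univ k)
    have := mul_pos hy hz
    simp at *
    linarith
  have hcov : ∀ y z, KWD y z → ∃ k, 0 < f k y ∧ 0 < h k z := by
    intro y z hd
    have e := hdecomp y z
    simp only [hs] at e
    rw [Finset.sum_eq_zero (fun j _ => if_neg (hd j))] at e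
    by_contra! hc
    rw [Finset.sum_eq_zero] at e
    · norm_num at e
    · intro k _
      rcases (hf k y).lt_or_eq with h0 | h0
      · rw [le_antisymm (hc k h0) (hh k z), mul_zero]
      · rw [← h0, zero_mul]
  have key : 3 ^ n ≤ N * 2 ^ n := by
    calc 3 ^ n = ∑ y : Fin n → Bool, ∑ z : Fin n → Bool, (if KWD y z then 1 else 0) :=
          (kw_total n).symm
      _ ≤ ∑ y : Fin n → Bool, ∑ z : Fin n → Bool, ∑ k : Fin N,
            (if 0 < f k y ∧ 0 < h k z ∧ KWD y z then 1 else 0) := by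
          refine Finset.sum_le_sum fun y _ => Finset.sum_le_sum fun z _ => ?_
          split_ifs with hd
          · obtain ⟨k, h1, h2⟩ := hcov y z hd
            have := Finset.single_le_sum
              (f := fun k => if 0 < f k y ∧ 0 < h k z ∧ KWD y z then 1 else 0)
              (fun k _ => Nat.zero_le _) (Finset.mem_univ k)
            simpa only [if_pos (And.intro h1 (And.intro h2 hd))] using this
          · exact Nat.zero_le _
      _ = ∑ k : Fin N, ∑ y : Fin n → Bool, ∑ z : Fin n → Bool,
            (if 0 < f k y ∧ 0 < h k z ∧ KWD y z then 1 else 0) := by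
          rw [Finset.sum_comm]
          simp_rw [Finset.sum_comm (s := (Finset.univ : Finset (Fin n → Bool)))
            (t := (Finset.univ : Finset (Fin N)))]
          refine Finset.sum_congr rfl fun k _ => Finset.sum_comm
      _ ≤ ∑ k : Fin N, 2 ^ n := Finset.sum_le_sum fun k _ =>
          kw_rect n (fun y => 0 < f k y) (fun z => 0 < h k z) (hrect k)
      _ = N * 2 ^ n := by simp
  rw [div_pow, div_le_iff₀ (by positivity)]
  exact_mod_cast key
end

section
/- There exist a real constant ε > 0 and a natural number d such that for every natural number n there exists a finite simple graph G on at least n vertices with maximum degree at most d and expansion ε, i.e., for every subset S of the vertices with |S| ≤ |V(G)|/2, the number of edges of G from S to its complement is at least ε·|S|. -/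
open Finset in
lemma exp_choose_mono (n r s : ℕ) (h : r ≤ s) (hs : 2 * s ≤ n) : n.choose r ≤ n.choose s := by
  induction s, h using Nat.le_induction with
  | base => exact le_rfl
  | succ s h ih =>
    exact (ih (by omega)).trans (Nat.choose_le_succ_of_lt_half_left (by omega))

lemma exp_two_pow_le (s : ℕ) : 2 ^ s ≤ Nat.centralBinom s := by
  induction s with
  | zero => simp
  | succ s ih =>
    have h := Nat.succ_mul_centralBinom_succ s
    have : (s + 1) * (2 * Nat.centralBinom s) ≤ (s + 1) * Nat.centralBinom (s + 1) := by
      rw [h]; nlinarith [Nat.zero_le (s * Nat.centralBinom s)]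
    have := Nat.le_of_mul_le_mul_left this (by omega)
    rw [pow_succ]; omega

lemma exp_choose_sq (s t : ℕ) (h : 10 * t ≤ s) : ((s + t).choose s) ^ 2 ≤ 2 ^ s := by
  have h1 : 8 ^ s * (s + t).choose s ≤ 9 ^ (s + t) := by
    have := add_pow 8 1 (s + t)
    have h2 : (8 : ℕ) ^ s * 1 ^ (s + t - s) * (s + t).choose s ≤ (8 + 1) ^ (s + t) := by
      rw [this]
      exact Finset.single_le_sum (f := fun m => 8 ^ m * 1 ^ (s + t - m) * (s + t).choose m)
        (fun _ _ => Nat.zero_le _) (Finset.mem_range.2 (by omega))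
    simpa using h2
  have h3 : 81 ^ (s + t) ≤ 128 ^ s := by
    obtain ⟨r, rfl⟩ := Nat.exists_eq_add_of_le h
    calc 81 ^ (10 * t + r + t) = (81 ^ 11) ^ t * 81 ^ r := by
          rw [← pow_mul, ← pow_add]; congr 1; ring
      _ ≤ (128 ^ 10) ^ t * 128 ^ r :=
          Nat.mul_le_mul (Nat.pow_le_pow_left (by norm_num) t) (Nat.pow_le_pow_left (by norm_num) r)
      _ = 128 ^ (10 * t + r) := by rw [← pow_mul, ← pow_add]
  have h4 : 64 ^ s * ((s + t).choose s) ^ 2 ≤ 64 ^ s * 2 ^ s := by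
    calc 64 ^ s * ((s + t).choose s) ^ 2 = (8 ^ s * (s + t).choose s) ^ 2 := by
          rw [mul_pow, ← pow_mul, mul_comm s 2, pow_mul]; norm_num
      _ ≤ (9 ^ (s + t)) ^ 2 := by gcongr
      _ = 81 ^ (s + t) := by rw [← pow_mul, mul_comm, pow_mul]; norm_num
      _ ≤ 128 ^ s := h3
      _ = 64 ^ s * 2 ^ s := by rw [← mul_pow]; norm_num
  exact Nat.le_of_mul_le_mul_left h4 (by positivity)

/-- permutations mapping S into U -/
def expPerms {n : ℕ} (S U : Finset (Fin n)) : Finset (Equiv.Perm (Fin n)) :=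
  Finset.univ.filter fun p => S.map p.toEmbedding ⊆ U

def expPermsEq {n : ℕ} (S W : Finset (Fin n)) : Finset (Equiv.Perm (Fin n)) :=
  Finset.univ.filter fun p => S.map p.toEmbedding = W

lemma exp_exists_perm {n : ℕ} (W W' : Finset (Fin n)) (h : W.card = W'.card) :
    ∃ q : Equiv.Perm (Fin n), W.map q.toEmbedding = W' := by
  let e : {x // x ∈ W} ≃ {x // x ∈ W'} := Finset.equivOfCardEq h
  refine ⟨e.extendSubtype, ?_⟩
  apply Finset.eq_of_subset_of_card_le
  · intro y hy
    obtain ⟨x, hx, rfl⟩ := Finset.mem_map.1 hy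
    exact e.extendSubtype_mem x hx
  · rw [Finset.card_map, h]

lemma exp_card_eq {n : ℕ} (S W W' : Finset (Fin n)) (h : W.card = W'.card) :
    (expPermsEq S W).card ≤ (expPermsEq S W').card := by
  obtain ⟨q, hq⟩ := exp_exists_perm W W' h
  apply Finset.card_le_card_of_injOn (fun p => q * p)
  · intro p hp
    simp only [expPermsEq, Finset.coe_filter, Finset.mem_univ, true_and, Set.mem_ofPred_eq] at hp ⊢
    rw [← hq, ← hp, Finset.map_map]
    rfl
  · intro a _ b _ hab
    exact mul_left_cancel hab

lemma exp_card_sum {n : ℕ} (S U : Finset (Fin n)) :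
    (expPerms S U).card = ∑ W ∈ U.powersetCard S.card, (expPermsEq S W).card := by
  rw [Finset.card_eq_sum_card_fiberwise (f := fun p : Equiv.Perm (Fin n) => S.map p.toEmbedding)
    (t := U.powersetCard S.card)]
  · apply Finset.sum_congr rfl
    intro W hW
    congr 1
    ext p
    simp only [expPerms, expPermsEq, Finset.mem_filter, Finset.mem_univ, true_and]
    constructor
    · exact fun h => h.2
    · rintro rfl
      exact ⟨(Finset.mem_powersetCard.1 hW).1, rfl⟩
  · intro p hp
    simp only [expPerms, Finset.coe_filter, Finset.mem_univ, true_and, Set.mem_ofPred_eq] at hp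
    simp [Finset.mem_powersetCard, hp]

lemma exp_card_perms {n : ℕ} (S U : Finset (Fin n)) :
    (expPerms S U).card * n.choose S.card = U.card.choose S.card * n.factorial := by
  have key : ∀ U : Finset (Fin n),
      (expPerms S U).card = U.card.choose S.card * (expPermsEq S S).card := by
    intro U
    rw [exp_card_sum, Finset.sum_const_nat (m := (expPermsEq S S).card), Finset.card_powersetCard]
    intro W hW
    have := (Finset.mem_powersetCard.1 hW).2
    exact le_antisymm (exp_card_eq _ _ _ this) (exp_card_eq _ _ _ this.symm)
  have h1 := key Finset.univ
  have h2 : (expPerms S Finset.univ).card = n.factorial := by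
    simp [expPerms, Fintype.card_perm]
  rw [h2, Finset.card_univ, Fintype.card_fin] at h1
  rw [key U, h1]; ring

lemma exp_prob {n : ℕ} (S U : Finset (Fin n)) (hS : 2 * S.card ≤ n)
    (hU : U.card ≤ S.card + S.card / 10) :
    (((expPerms S U).card : ℝ) / n.factorial) ^ 2 ≤ 1 / (n.choose S.card : ℝ) := by
  set s := S.card with hs
  have hC : 0 < n.choose s := Nat.choose_pos (by omega)
  have h1 := exp_card_perms S U
  rw [← hs] at h1
  have h2 : (U.card.choose s) ^ 2 ≤ n.choose s := by
    calc (U.card.choose s) ^ 2 ≤ ((s + s / 10).choose s) ^ 2 :=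
          Nat.pow_le_pow_left (Nat.choose_le_choose _ hU) 2
      _ ≤ 2 ^ s := exp_choose_sq _ _ (by omega)
      _ ≤ (2 * s).choose s := exp_two_pow_le s
      _ ≤ n.choose s := Nat.choose_le_choose _ hS
  have hC' : (0 : ℝ) < n.choose s := by exact_mod_cast hC
  have hF : (0 : ℝ) < n.factorial := by exact_mod_cast n.factorial_pos
  have h1' : ((expPerms S U).card : ℝ) * n.choose s = U.card.choose s * n.factorial := by
    exact_mod_cast h1
  have h2' : ((U.card.choose s : ℝ)) ^ 2 ≤ n.choose s := by exact_mod_cast h2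
  have h3 : ((expPerms S U).card : ℝ) / n.factorial = U.card.choose s / n.choose s := by
    field_simp; linarith
  rw [h3, div_pow, div_le_div_iff₀ (by positivity) hC']
  nlinarith

lemma exp_exists (n : ℕ) (hn : 2 ≤ n) : ∃ F : Fin 8 → Equiv.Perm (Fin n),
    ∀ S T : Finset (Fin n), 1 ≤ S.card → 2 * S.card ≤ n → T.card = S.card / 10 →
      ∃ i, ¬ S.map (F i).toEmbedding ⊆ S ∪ T := by
  by_contra! hcon
  let B : Finset (Fin 8 → Equiv.Perm (Fin n)) :=
    (Finset.Icc 1 (n / 2)).biUnion fun s =>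
      (Finset.univ.powersetCard s).biUnion fun S =>
        (Finset.univ.powersetCard (s / 10)).biUnion fun T =>
          Fintype.piFinset fun _ => expPerms S (S ∪ T)
  have hB : B = Finset.univ := by
    ext F
    simp only [Finset.mem_univ, iff_true]
    obtain ⟨S, T, h1, h2, h3, h4⟩ := hcon F
    simp only [B, Finset.mem_biUnion, Finset.mem_powersetCard, Finset.mem_Icc]
    refine ⟨S.card, ⟨h1, by omega⟩, S, ⟨Finset.subset_univ _, rfl⟩, T,
      ⟨Finset.subset_univ _, h3⟩, ?_⟩
    simpa [expPerms] using h4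
  have hF : (0 : ℝ) < n.factorial := by exact_mod_cast n.factorial_pos
  have hn0 : (0 : ℝ) < n := by exact_mod_cast (by omega : 0 < n)
  have hone : ∀ s ∈ Finset.Icc 1 (n / 2), ∀ S ∈ (Finset.univ : Finset (Fin n)).powersetCard s,
      ∀ T ∈ (Finset.univ : Finset (Fin n)).powersetCard (s / 10),
      ((Fintype.piFinset fun _ : Fin 8 => expPerms S (S ∪ T)).card : ℝ)
        ≤ (n.factorial : ℝ) ^ 8 * (1 / (n.choose s : ℝ)) ^ 4 := by
    intro s hs S hS T hT
    rw [Finset.mem_Icc] at hs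
    have hS := (Finset.mem_powersetCard.1 hS).2
    have hT := (Finset.mem_powersetCard.1 hT).2
    subst hS
    have hU : (S ∪ T).card ≤ S.card + S.card / 10 := by
      rw [← hT]; exact Finset.card_union_le _ _
    have hp := exp_prob S (S ∪ T) (by omega) hU
    have hp4 := pow_le_pow_left₀ (by positivity) hp 4
    rw [Fintype.card_piFinset]
    simp only [Finset.prod_const, Finset.card_univ, Fintype.card_fin]
    push_cast
    calc ((expPerms S (S ∪ T)).card : ℝ) ^ 8
        = (n.factorial : ℝ) ^ 8 * ((((expPerms S (S ∪ T)).card : ℝ) / n.factorial) ^ 2) ^ 4 := by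
          field_simp
      _ ≤ _ := by gcongr
  have hs1 : ∀ s ∈ Finset.Icc 1 (n / 2),
      (((Finset.univ.powersetCard s).biUnion fun S : Finset (Fin n) =>
        (Finset.univ.powersetCard (s / 10)).biUnion fun T =>
          Fintype.piFinset fun _ : Fin 8 => expPerms S (S ∪ T)).card : ℝ)
        ≤ (n.factorial : ℝ) ^ 8 * (1 / (n : ℝ)) ^ 2 := by
    intro s hs
    have hs' := Finset.mem_Icc.1 hs
    have hCn : n ≤ n.choose s := by
      simpa using exp_choose_mono n 1 s hs'.1 (by omega)
    have hCt : n.choose (s / 10) ≤ n.choose s :=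
      exp_choose_mono n (s / 10) s (by omega) (by omega)
    have hCn' : (n : ℝ) ≤ n.choose s := by exact_mod_cast hCn
    have hCt' : (n.choose (s / 10) : ℝ) ≤ n.choose s := by exact_mod_cast hCt
    have hC0 : (0 : ℝ) < n.choose s := lt_of_lt_of_le hn0 hCn'
    calc _ ≤ ((∑ S ∈ (Finset.univ : Finset (Fin n)).powersetCard s,
            ∑ T ∈ (Finset.univ : Finset (Fin n)).powersetCard (s / 10),
            (Fintype.piFinset fun _ : Fin 8 => expPerms S (S ∪ T)).card : ℕ) : ℝ) := by
          exact_mod_cast Finset.card_biUnion_le.trans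
            (Finset.sum_le_sum fun S _ => Finset.card_biUnion_le)
      _ = ∑ S ∈ (Finset.univ : Finset (Fin n)).powersetCard s,
            ∑ T ∈ (Finset.univ : Finset (Fin n)).powersetCard (s / 10),
            ((Fintype.piFinset fun _ : Fin 8 => expPerms S (S ∪ T)).card : ℝ) := by
          push_cast; rfl
      _ ≤ ∑ S ∈ (Finset.univ : Finset (Fin n)).powersetCard s,
            ∑ T ∈ (Finset.univ : Finset (Fin n)).powersetCard (s / 10),
            (n.factorial : ℝ) ^ 8 * (1 / (n.choose s : ℝ)) ^ 4 :=
          Finset.sum_le_sum fun S hS => Finset.sum_le_sum fun T hT => hone s hs S hS T hT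
      _ = n.choose s * (n.choose (s / 10) *
            ((n.factorial : ℝ) ^ 8 * (1 / (n.choose s : ℝ)) ^ 4)) := by
          simp [Finset.sum_const, Finset.card_powersetCard]
      _ ≤ n.choose s * (n.choose s *
            ((n.factorial : ℝ) ^ 8 * (1 / (n.choose s : ℝ)) ^ 4)) := by gcongr
      _ = (n.factorial : ℝ) ^ 8 * (1 / (n.choose s : ℝ)) ^ 2 := by field_simp
      _ ≤ _ := by gcongr
  have htot : (B.card : ℝ) ≤ n * ((n.factorial : ℝ) ^ 8 * (1 / (n : ℝ)) ^ 2) / 2 := by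
    calc (B.card : ℝ) ≤ ((∑ s ∈ Finset.Icc 1 (n / 2),
          ((Finset.univ.powersetCard s).biUnion fun S : Finset (Fin n) =>
            (Finset.univ.powersetCard (s / 10)).biUnion fun T =>
              Fintype.piFinset fun _ : Fin 8 => expPerms S (S ∪ T)).card : ℕ) : ℝ) :=
          Nat.cast_le.2 Finset.card_biUnion_le
      _ ≤ ∑ s ∈ Finset.Icc 1 (n / 2), (n.factorial : ℝ) ^ 8 * (1 / (n : ℝ)) ^ 2 := by
          push_cast
          exact Finset.sum_le_sum hs1
      _ = ((n / 2 : ℕ) : ℝ) * ((n.factorial : ℝ) ^ 8 * (1 / (n : ℝ)) ^ 2) := by simp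
      _ ≤ ((n : ℝ) / 2) * ((n.factorial : ℝ) ^ 8 * (1 / (n : ℝ)) ^ 2) := by
          gcongr
          exact Nat.cast_div_le
      _ = _ := by ring
  have hcard : (B.card : ℝ) = (n.factorial : ℝ) ^ 8 := by
    rw [hB]
    simp [Fintype.card_perm]
  rw [hcard] at htot
  have h8 : (0 : ℝ) < (n.factorial : ℝ) ^ 8 := by positivity
  have hn1 : (1 : ℝ) < n := by exact_mod_cast (by omega : 1 < n)
  have : (n : ℝ) * ((n.factorial : ℝ) ^ 8 * (1 / (n : ℝ)) ^ 2) / 2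
      = (n.factorial : ℝ) ^ 8 * (1 / n) / 2 := by field_simp
  rw [this] at htot
  have h9 : 1 / (n : ℝ) < 1 := by rw [div_lt_one hn0]; exact hn1
  nlinarith

/-- There exist `ε > 0` and `d` such that for every `n` there is a finite simple graph
on at least `n` vertices with maximum degree at most `d` and expansion `ε`:
every vertex set `S` of size at most half the vertices has at least `ε·|S|` edges
leaving it. -/
theorem exists_bounded_degree_expander_family :
    ∃ ε : ℝ, 0 < ε ∧ ∃ d : ℕ, ∀ n : ℕ,
      ∃ (V : Type) (G : SimpleGraph V), Finite V ∧ n ≤ Nat.card V ∧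
        (∀ v : V, (G.neighborSet v).ncard ≤ d) ∧
        (∀ S : Set V, (Nat.card S : ℝ) ≤ (Nat.card V : ℝ) / 2 →
          ε * (Nat.card S : ℝ)
            ≤ (({e ∈ G.edgeSet | ∃ u ∈ S, ∃ v ∈ Sᶜ, e = s(u, v)}).ncard : ℝ)) := by
  classical
  refine ⟨1 / 10, by norm_num, 16, fun n => ?_⟩
  obtain ⟨F, hF⟩ := exp_exists (n + 2) (by omega)
  let G : SimpleGraph (Fin (n + 2)) :=
    SimpleGraph.fromRel fun u v => ∃ i, F i u = v
  refine ⟨Fin (n + 2), G, inferInstance, by simp, ?_, ?_⟩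
  · intro v
    have hsub : G.neighborSet v ⊆
        ((Finset.univ.image fun i => F i v) ∪ (Finset.univ.image fun i => (F i).symm v) :
          Finset (Fin (n + 2))) := by
      intro w hw
      have hw' : G.Adj v w := hw
      rw [SimpleGraph.fromRel_adj] at hw'
      obtain ⟨-, ⟨i, hi⟩ | ⟨i, hi⟩⟩ := hw'
      · simp only [Finset.coe_union, Set.mem_union, Finset.mem_coe, Finset.mem_image]
        exact Or.inl ⟨i, Finset.mem_univ _, hi⟩
      · simp only [Finset.coe_union, Set.mem_union, Finset.mem_coe, Finset.mem_image]
        exact Or.inr ⟨i, Finset.mem_univ _, by rw [← hi]; simp⟩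
    refine (Set.ncard_le_ncard hsub (Finset.finite_toSet _)).trans ?_
    rw [Set.ncard_coe_finset]
    refine (Finset.card_union_le _ _).trans ?_
    have h1 := Finset.card_image_le (s := Finset.univ) (f := fun i => F i v)
    have h2 := Finset.card_image_le (s := Finset.univ) (f := fun i => (F i).symm v)
    simp only [Finset.card_univ, Fintype.card_fin] at h1 h2
    omega
  · intro S hS
    set E := {e ∈ G.edgeSet | ∃ u ∈ S, ∃ v ∈ Sᶜ, e = s(u, v)} with hE
    let S' : Finset (Fin (n + 2)) := S.toFinset
    have hSc : Nat.card S = S'.card := by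
      simp [S', Nat.card_eq_fintype_card, Set.toFinset_card]
    rw [hSc] at hS ⊢
    by_contra! hlt
    have hEc : E.ncard ≤ S'.card / 10 := by
      have : (10 * E.ncard : ℝ) < S'.card := by linarith
      have : 10 * E.ncard < S'.card := by exact_mod_cast this
      omega
    have hpos : 1 ≤ S'.card := by
      rcases Nat.eq_zero_or_pos S'.card with h | h
      · rw [h] at hlt
        have : (0 : ℝ) ≤ E.ncard := Nat.cast_nonneg _
        norm_num at hlt
        linarith
      · exact h
    have hhalf : 2 * S'.card ≤ n + 2 := by
      simp only [Nat.card_eq_fintype_card, Fintype.card_fin] at hS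
      have : (2 * S'.card : ℝ) ≤ ((n + 2 : ℕ) : ℝ) := by linarith
      exact_mod_cast this
    let T0 : Finset (Fin (n + 2)) :=
      Finset.univ.filter fun w => w ∉ S ∧ ∃ u ∈ S, ∃ i, F i u = w
    have hT0 : T0.card ≤ E.ncard := by
      have hch : ∀ w ∈ T0, ∃ u ∈ S, w ∉ S ∧ s(u, w) ∈ E := by
        intro w hw
        obtain ⟨hwS, u, hu, i, hi⟩ := (Finset.mem_filter.1 hw).2
        refine ⟨u, hu, hwS, ?_, u, hu, w, hwS, rfl⟩
        rw [SimpleGraph.mem_edgeSet, SimpleGraph.fromRel_adj]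
        exact ⟨fun h => hwS (h ▸ hu), Or.inl ⟨i, hi⟩⟩
      choose! g hg using hch
      rw [← Set.ncard_coe_finset]
      refine Set.ncard_le_ncard_of_injOn (fun w => s(g w, w)) (fun w hw => (hg w hw).2.2) ?_
        (Set.toFinite _)
      intro a ha b hb hab
      rcases Sym2.eq_iff.1 hab with h | h
      · exact h.2
      · exact absurd (h.1 ▸ (hg a ha).1) (hg b hb).2.1
    obtain ⟨T, hTsub, hTc⟩ := Finset.exists_superset_card_eq (s := T0) (n := S'.card / 10)
      (hT0.trans hEc) (by rw [Fintype.card_fin]; omega)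
    obtain ⟨i, hi⟩ := hF S' T hpos hhalf hTc
    apply hi
    intro w hw
    obtain ⟨u, hu, rfl⟩ := Finset.mem_map.1 hw
    have hu' : u ∈ S := by simpa [S'] using hu
    rw [Finset.mem_union]
    by_cases hwS : F i u ∈ S
    · left; simpa [S'] using hwS
    · right
      apply hTsub
      exact Finset.mem_filter.2 ⟨Finset.mem_univ _, hwS, u, hu', i, rfl⟩
end
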